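/- arXiv:2508.21185 — 2 statements merged into one kernel-verified Lean document; each statement's English description precedes it below -/
import Mathlib

section
/- The edge-distinguishing chromatic number of the triangular book graph B_n on n vertices equals n for all n ≥ 3; equivalently, any edge-distinguishing coloring of B_n is injective on vertices. -/
/-- A `k`-coloring `c` of the vertices of `G` is *edge-distinguishing* if the induced
edge coloring, sending each edge `{u,v}` to the unordered pair `{c u, c v}`, is
injective on the edge set. -/
def edgeDist {V : Type*} (G : SimpleGraph V) {k : ℕ} (c : V → Fin k) : Prop :=
  Set.InjOn (Sym2.map c) G.edgeSet

/-- The triangular book graph `B_n`: spine vertices `0, 1` are adjacent to each other and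
to all other vertices; the remaining `n - 2` page vertices form an independent set. -/
def bookG (n : ℕ) : SimpleGraph (Fin n) :=
  SimpleGraph.fromRel (fun u v => (u : ℕ) = 0 ∨ (u : ℕ) = 1)

theorem stmt_5 (n : ℕ) (hn : 3 ≤ n) :
    IsLeast {k : ℕ | ∃ c : Fin n → Fin k, edgeDist (bookG n) c} n ∧
    ∀ (k : ℕ) (c : Fin n → Fin k), edgeDist (bookG n) c → Function.Injective c := by
  have key : ∀ (k : ℕ) (c : Fin n → Fin k), edgeDist (bookG n) c → Function.Injective c := by
    intro k c hc u v huv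
    by_contra hne
    have hw : ∃ w : Fin n, (bookG n).Adj w u ∧ (bookG n).Adj w v := by
      simp only [bookG, SimpleGraph.fromRel_adj, ne_eq, Fin.ext_iff] at hne ⊢
      by_cases h0 : (u : ℕ) ≠ 0 ∧ (v : ℕ) ≠ 0
      · exact ⟨⟨0, by omega⟩, by simp only [true_or, and_true]; omega, by simp only [true_or, and_true]; omega⟩
      by_cases h1 : (u : ℕ) ≠ 1 ∧ (v : ℕ) ≠ 1
      · exact ⟨⟨1, by omega⟩, by simp only [true_or, or_true, and_true]; omega, by simp only [true_or, or_true, and_true]; omega⟩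
      · exact ⟨⟨2, by omega⟩, by simp only; omega, by simp only; omega⟩
    obtain ⟨w, h1, h2⟩ := hw
    have h := hc (show s(w, u) ∈ (bookG n).edgeSet from h1)
      (show s(w, v) ∈ (bookG n).edgeSet from h2) (by simp [Sym2.map_mk, huv])
    exact hne (Sym2.congr_right.mp h)
  refine ⟨⟨⟨id, ?_⟩, ?_⟩, key⟩
  · intro a _ b _ h
    simpa using h
  · rintro k ⟨c, hc⟩
    simpa using Fintype.card_le_of_injective c (key k c hc)
end

section
/- The cycle C_4 admits no edge-distinguishing 2-coloring but admits an edge-distinguishing 3-coloring; hence λ(C_4) = 3. -/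
/-- The cycle graph on `m` vertices, with vertex set `ZMod m` and edges `{i, i+1}`. -/
def cycleG (m : ℕ) : SimpleGraph (ZMod m) :=
  SimpleGraph.fromRel (fun u v => v = u + 1)

theorem edgeDist_C4_iff {k : ℕ} (c : ZMod 4 → Fin k) :
    edgeDist (cycleG 4) c ↔
      ∀ i j : ZMod 4, s(c i, c (i+1)) = s(c j, c (j+1)) → i = j := by
  have hadj : ∀ i : ZMod 4, s(i, i+1) ∈ (cycleG 4).edgeSet := by
    intro i
    rw [SimpleGraph.mem_edgeSet, cycleG, SimpleGraph.fromRel_adj]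
    exact ⟨by revert i; decide, Or.inl rfl⟩
  have hex : ∀ e ∈ (cycleG 4).edgeSet, ∃ i : ZMod 4, e = s(i, i+1) := by
    intro e
    induction e using Sym2.ind with
    | _ u v =>
      intro h
      rw [SimpleGraph.mem_edgeSet, cycleG, SimpleGraph.fromRel_adj] at h
      rcases h.2 with h | h
      · exact ⟨u, by rw [h]⟩
      · exact ⟨v, by rw [h, Sym2.eq_swap]⟩
  have hinj : ∀ i j : ZMod 4, s(i, i+1) = s(j, j+1) → i = j := by decide
  constructor
  · intro h i j hij
    exact hinj i j (h (hadj i) (hadj j) (by simpa only [Sym2.map_mk] using hij))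
  · intro h e he f hf hef
    obtain ⟨i, rfl⟩ := hex e he
    obtain ⟨j, rfl⟩ := hex f hf
    rw [h i j (by simpa only [Sym2.map_mk] using hef)]

theorem no_two_C4 (c : ZMod 4 → Fin 2) : ¬ edgeDist (cycleG 4) c := by
  rw [edgeDist_C4_iff]
  intro h
  have hi : Function.Injective (fun i : ZMod 4 => s(c i, c (i+1))) := fun i j hij => h i j hij
  have h1 := Fintype.card_le_of_injective _ hi
  have h2 : Fintype.card (Sym2 (Fin 2)) = 3 := by decide
  rw [h2, ZMod.card] at h1
  omega

theorem three_C4 : ∃ c : ZMod 4 → Fin 3, edgeDist (cycleG 4) c := by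
  refine ⟨fun i => if i = 2 then 1 else if i = 3 then 2 else 0, ?_⟩
  rw [edgeDist_C4_iff]
  decide

theorem stmt_8 :
    ¬ (∃ c : ZMod 4 → Fin 2, edgeDist (cycleG 4) c) ∧
    (∃ c : ZMod 4 → Fin 3, edgeDist (cycleG 4) c) ∧
    IsLeast {k : ℕ | ∃ c : ZMod 4 → Fin k, edgeDist (cycleG 4) c} 3 := by 
  refine ⟨fun ⟨c, hc⟩ => no_two_C4 c hc, three_C4, three_C4, ?_⟩
  rintro k ⟨c, hc⟩
  by_contra hk
  have hk2 : k ≤ 2 := by omega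
  refine no_two_C4 (fun i => Fin.castLE hk2 (c i)) ?_
  intro e he f hf hef
  apply hc he hf
  apply Sym2.map.injective (Fin.castLE_injective hk2)
  rw [Sym2.map_map, Sym2.map_map]
  exact hef
end
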